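/- arXiv:math/9502209 — 2 statements merged into one kernel-verified Lean document; each statement's English description precedes it below -/
import Mathlib

section
/- Let N ≥ 1, let k be a positive even integer, and let (a_n) be complex numbers with a_n = O(n^C) for some C > 0. Suppose F(s) = Σ_{n≥1} a_n n^{−s} satisfies a functional equation of degree 2, level N, weight k: Φ(s) = (√N/(2π))^s Γ(s) F(s) extends to an entire function, bounded in every vertical strip, with Φ(s) = ε(−1)^{k/2} Φ(k−s) for some ε ∈ {+1,−1}. Then f(z) = Σ_{n≥1} a_n e^{2πinz} satisfies f|_k P = f, f|_k H_N = ε f, and consequently f|_k W_N = f, where P = ((1,1),(0,1)), H_N = ((0,−1),(N,0)), and W_N = ((1,0),(N,1)). (Lemma 1, functional equation part.) -/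
open UpperHalfPlane Matrix Complex MatrixGroups Asymptotics Filter Topology
open scoped Manifold

set_option synthInstance.maxHeartbeats 1000000 in
/-- Action of a real 2×2 matrix with positive determinant on the upper
half-plane `ℍ` (junk value `z` if the determinant is not positive). -/
noncomputable def glAct (γ : Matrix (Fin 2) (Fin 2) ℝ) (z : ℍ) : ℍ :=
  if h : 0 < γ.det then
    (⟨Matrix.GeneralLinearGroup.mkOfDetNeZero γ h.ne', by
        simpa [Matrix.GeneralLinearGroup.mkOfDetNeZero] using h⟩ : GL(2, ℝ)⁺) • z
  else z

/-- For an even integer `k`, the weight-`k` slash action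
`(f ∣ₖ γ)(z) = (det γ)^(k/2) (cz+d)^(-k) f(γz)`. -/
noncomputable def slash (k : ℤ) (γ : Matrix (Fin 2) (Fin 2) ℝ) (f : ℍ → ℂ) : ℍ → ℂ :=
  fun z => (γ.det : ℂ) ^ (k / 2) * (γ 1 0 * (z : ℂ) + γ 1 1) ^ (-k) * f (glAct γ z)

/-- An element of `SL(2, ℤ)` as a real matrix. -/
def sl2ToReal (γ : Matrix.SpecialLinearGroup (Fin 2) ℤ) : Matrix (Fin 2) (Fin 2) ℝ :=
  (γ : Matrix (Fin 2) (Fin 2) ℤ).map (Int.cast)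

/-- The function `f(z) = Σ_{n ≥ 1} a_n e^{2πinz}` on the upper half-plane. -/
noncomputable def fourierSeries (a : ℕ → ℂ) : ℍ → ℂ :=
  fun z => ∑' n : ℕ, a (n + 1) *
    Complex.exp (2 * (Real.pi : ℂ) * Complex.I * ((n : ℂ) + 1) * (z : ℂ))

/-- The Dirichlet series `F(s) = Σ_{n ≥ 1} a_n n^{-s}`. -/
noncomputable def dirichletSeries (a : ℕ → ℂ) (s : ℂ) : ℂ :=
  ∑' n : ℕ, a (n + 1) / ((n : ℂ) + 1) ^ s

/-- The action of the Hecke operator `T_p` in weight `k`: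
`f|_k T_p = f|_k ((p,0),(0,1)) + Σ_{b=0}^{p-1} f|_k ((1,b),(0,p))`. -/
noncomputable def heckeT (k : ℤ) (p : ℕ) (f : ℍ → ℂ) : ℍ → ℂ :=
  fun z => slash k !![(p : ℝ), 0; 0, 1] f z +
    ∑ b ∈ Finset.range p, slash k !![1, (b : ℝ); 0, (p : ℝ)] f z

/-- The action of the Atkin–Lehner operator `U_q` in weight `k`:
`f|_k U_q = Σ_{b=0}^{q-1} f|_k ((q,b),(0,q))`. -/
noncomputable def atkinLehnerU (k : ℤ) (q : ℕ) (f : ℍ → ℂ) : ℍ → ℂ :=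
  fun z => ∑ b ∈ Finset.range q, slash k !![(q : ℝ), (b : ℝ); 0, (q : ℝ)] f z

/-- The local factor at the prime `p` of an Euler product of degree 2,
level `N`, and weight `k`. -/
noncomputable def localFactor (a : ℕ → ℂ) (N : ℕ) (k : ℤ) (p : ℕ) (s : ℂ) : ℂ :=
  if p ∣ N then
    (if p ^ 2 ∣ N then 1 else (1 - (p : ℂ) ^ ((k : ℂ) / 2 - 1 - s))⁻¹)
  else (1 - a p * (p : ℂ) ^ (-s) + (p : ℂ) ^ ((k : ℂ) - 1 - 2 * s))⁻¹

section MellinRigidity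

open MeasureTheory Set

theorem norm_mellin_le_of_eq_zero_of_lt_one {p : ℝ → ℂ} (hp : ∀ t < 1, p t = 0) {s : ℂ} {σ : ℝ}
    (hs : s.re ≤ σ) (hσ : MellinConvergent p σ) :
    ‖mellin p s‖ ≤ ∫ t in Ioi (0 : ℝ), ‖(t : ℂ) ^ ((σ : ℂ) - 1) • p t‖ := by
  refine norm_integral_le_of_norm_le hσ.norm ?_
  filter_upwards [ae_restrict_mem measurableSet_Ioi] with t ht
  rcases lt_or_ge t 1 with h | h
  · simp [hp t h]
  · rw [norm_smul, norm_smul, norm_cpow_eq_rpow_re_of_pos ht, norm_cpow_eq_rpow_re_of_pos ht]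
    refine mul_le_mul_of_nonneg_right ?_ (norm_nonneg _)
    exact Real.rpow_le_rpow_of_exponent_le h (by simpa using hs)

theorem norm_mellin_le_of_eq_zero_of_one_lt {p : ℝ → ℂ} (hp : ∀ t, 1 < t → p t = 0) {s : ℂ} {σ : ℝ}
    (hs : σ ≤ s.re) (hσ : MellinConvergent p σ) :
    ‖mellin p s‖ ≤ ∫ t in Ioi (0 : ℝ), ‖(t : ℂ) ^ ((σ : ℂ) - 1) • p t‖ := by
  refine norm_integral_le_of_norm_le hσ.norm ?_
  filter_upwards [ae_restrict_mem measurableSet_Ioi] with t ht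
  rcases lt_or_ge 1 t with h | h
  · simp [hp t h]
  · rw [norm_smul, norm_smul, norm_cpow_eq_rpow_re_of_pos ht, norm_cpow_eq_rpow_re_of_pos ht]
    refine mul_le_mul_of_nonneg_right ?_ (norm_nonneg _)
    exact Real.rpow_le_rpow_of_exponent_ge ht h (by simpa using hs)

theorem eq_zero_of_mellin_eq_zero {w : ℝ → ℂ} {σ : ℝ} (hw : MellinConvergent w σ)
    (h0 : ∀ s : ℂ, s.re = σ → mellin w s = 0) {x : ℝ} (hx : 0 < x) (hc : ContinuousAt w x) :
    w x = 0 := by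
  have h (y : ℝ) : mellin w (σ + y * Complex.I) = 0 := h0 _ (by simp)
  rw [← mellinInv_mellin_eq σ w hx hw (by simp [VerticalIntegrable, h]) hc]
  simp [mellinInv, h]

/-- If the Mellin transform of `d` is a constant on a right half-plane, then `d` vanishes at its
points of continuity other than `1`. -/
theorem eq_zero_of_mellin_eq_const {d : ℝ → ℂ} {σ : ℝ} {K : ℂ}
    (hconv : ∀ s : ℂ, σ < s.re → MellinConvergent d s)
    (hd : ∀ s : ℂ, σ < s.re → mellin d s = K) {x : ℝ} (hx : 0 < x) (hx1 : x ≠ 1)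
    (hc : ContinuousAt d x) : d x = 0 := by
  have hshift {s : ℂ} (hs : σ < s.re) :
      HasMellin (fun t : ℝ ↦ d t - (t : ℂ) ^ (1 : ℂ) • d t) s (K - K) := by
    have hs1 : σ < (s + 1).re := by simp; linarith
    have := hasMellin_sub (hconv s hs) (MellinConvergent.cpow_smul (a := 1) |>.2 (hconv _ hs1))
    rwa [mellin_cpow_smul, hd _ hs, hd _ hs1] at this
  have hσ : σ < ((σ + 1 : ℝ) : ℂ).re := by simp
  have := eq_zero_of_mellin_eq_zero (hshift hσ).1
    (fun s hs ↦ by simpa using (hshift (s := s) (by linarith)).2) hx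
    (by simp only [cpow_one]; fun_prop)
  simp only [cpow_one, smul_eq_mul] at this
  have h1 : (1 - (x : ℂ)) * d x = 0 := by linear_combination this
  exact (mul_eq_zero.1 h1).resolve_left (sub_ne_zero.2 (by exact_mod_cast hx1.symm))

/-- A function whose Mellin transform continues to an entire function, bounded in vertical strips,
with a functional equation is itself modular under `x ↦ x⁻¹`. -/
theorem eq_cpow_mul_inv_of_mellin_functional_equation {g : ℝ → ℂ} (hgc : ContinuousOn g (Ioi 0))
    {A : ℝ} (hA : 0 < A) (hdecay : g =O[atTop] fun t ↦ Real.exp (-A * t)) {σ₀ : ℝ}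
    (hconv : ∀ s : ℂ, σ₀ < s.re → MellinConvergent g s) {Φ : ℂ → ℂ} (hΦ : Differentiable ℂ Φ)
    (hgΦ : ∀ s : ℂ, σ₀ < s.re → mellin g s = Φ s)
    (hbdd : ∀ σ₁ σ₂ : ℝ, ∃ M : ℝ, ∀ s : ℂ, σ₁ ≤ s.re → s.re ≤ σ₂ → ‖Φ s‖ ≤ M)
    {c : ℂ} (hc : c * c = 1) {k : ℝ} (hfe : ∀ s, Φ s = c * Φ (k - s))
    {x : ℝ} (hx : 0 < x) (hx1 : x < 1) :
    g x = c * ((x : ℂ) ^ (-(k : ℂ)) * g x⁻¹) := by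
  set p : ℝ → ℂ := (Ioi 1).indicator g with hp
  set r : ℝ → ℂ := fun t ↦ c • ((t : ℂ) ^ (-(k : ℂ)) • p t⁻¹) with hr
  have hp0 : ∀ t < 1, p t = 0 := fun t ht ↦ by simp [hp, ht.le]
  have hp1 : ∀ t, 1 < t → p t = g t := fun t ht ↦ by simp [hp, ht]
  have hploc : LocallyIntegrableOn p (Ioi 0) :=
    fun x hx ↦ (hgc.locallyIntegrableOn measurableSet_Ioi x hx).imp
      fun _ h ↦ ⟨h.1, h.2.indicator measurableSet_Ioi⟩
  have hptop : p =O[atTop] fun t ↦ Real.exp (-A * t) := by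
    refine hdecay.congr' ?_ .rfl
    filter_upwards [eventually_gt_atTop 1] with t ht
    exact (hp1 t ht).symm
  have hpbot (b : ℝ) : p =O[𝓝[>] 0] fun t : ℝ ↦ t ^ (-b) := by
    refine (isBigO_zero _ _).congr' ?_ .rfl
    filter_upwards [mem_nhdsWithin_of_mem_nhds (Iio_mem_nhds one_pos)] with t ht
    simp [hp0 t ht]
  have hpconv (s : ℂ) : MellinConvergent p s :=
    mellinConvergent_of_isBigO_rpow_exp hA hploc hptop (hpbot (s.re - 1)) (by linarith)
  have hpdiff : Differentiable ℂ (mellin p) := fun s ↦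
    mellin_differentiableAt_of_isBigO_rpow_exp hA hploc hptop (hpbot (s.re - 1)) (by linarith)
  have hrmellin (s : ℂ) : HasMellin r s (c * mellin p (k - s)) := by
    constructor
    · refine MellinConvergent.const_smul (MellinConvergent.cpow_smul.2 ?_) c
      have := (MellinConvergent.comp_rpow (f := p) (s := s + -k) (a := -1) (by norm_num)).2 (hpconv _)
      simpa only [Real.rpow_neg_one] using this
    · rw [hr, mellin_const_smul, mellin_cpow_smul, mellin_comp_inv, smul_eq_mul]
      congr 2
      ring
  set d : ℝ → ℂ := fun t ↦ g t - p t - r t with hd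
  have hdmellin {s : ℂ} (hs : σ₀ < s.re) :
      HasMellin d s (Φ s - mellin p s - c * mellin p (k - s)) := by
    have h1 := hasMellin_sub (hconv s hs) (hpconv s)
    have h2 := hasMellin_sub h1.1 (hrmellin s).1
    rwa [h1.2, (hrmellin s).2, hgΦ s hs] at h2
  have hd0 : ∀ t, 1 < t → d t = 0 := fun t ht ↦ by
    have : p t⁻¹ = 0 := hp0 _ (inv_lt_one_of_one_lt₀ ht)
    simp [hd, hr, this, hp1 t ht]
  set E : ℂ → ℂ := fun s ↦ Φ s - mellin p s - c * mellin p (k - s) with hE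
  have hEdiff : Differentiable ℂ E := by
    have : Differentiable ℂ fun s : ℂ ↦ mellin p (k - s) := hpdiff.comp (by fun_prop)
    fun_prop
  have hEfe (s : ℂ) : E s = c * E (k - s) := by
    simp only [hE, sub_sub_cancel]
    rw [hfe s]
    linear_combination (mellin p s) * hc
  set σ₁ := σ₀ + 1
  set B := ∫ t in Ioi (0 : ℝ), ‖(t : ℂ) ^ ((σ₁ : ℂ) - 1) • d t‖
  set B' := ∫ t in Ioi (0 : ℝ), ‖(t : ℂ) ^ ((σ₁ : ℂ) - 1) • p t‖
  have hEright {s : ℂ} (hs : σ₁ ≤ s.re) : ‖E s‖ ≤ B := by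
    simp only [hE]
    rw [← (hdmellin (s := s) (by simp only [σ₁] at hs; linarith)).2]
    exact norm_mellin_le_of_eq_zero_of_one_lt hd0 hs (hdmellin (by simp [σ₁])).1
  have hcn : ‖c‖ = 1 := by
    have : ‖c‖ * ‖c‖ = 1 := by rw [← norm_mul, hc, norm_one]
    nlinarith [norm_nonneg c]
  obtain ⟨M, hM⟩ := hbdd (k - σ₁) σ₁
  have hEbdd (s : ℂ) : ‖E s‖ ≤ max B (M + B' + B') := by
    rcases le_total σ₁ s.re with h | h
    · exact (hEright h).trans (le_max_left _ _)
    rcases le_total s.re (k - σ₁) with h' | h'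
    · rw [hEfe, norm_mul, hcn, one_mul]
      exact (hEright (by simp; linarith)).trans (le_max_left _ _)
    · refine le_max_of_le_right ?_
      have h1 : ‖mellin p s‖ ≤ B' := norm_mellin_le_of_eq_zero_of_lt_one hp0 h (hpconv _)
      have h2 : ‖c * mellin p (k - s)‖ ≤ B' := by
        rw [norm_mul, hcn, one_mul]
        exact norm_mellin_le_of_eq_zero_of_lt_one hp0 (by simp; linarith) (hpconv _)
      have h3 : ‖E s‖ ≤ ‖Φ s‖ + ‖mellin p s‖ + ‖c * mellin p (k - s)‖ :=
        (norm_sub_le _ _).trans <| by gcongr; exact norm_sub_le _ _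
      linarith [hM s h' h]
  have hEconst (s : ℂ) : E s = E 0 :=
    hEdiff.apply_eq_apply_of_bounded (isBounded_iff_forall_norm_le.2
      ⟨_, forall_mem_range.2 hEbdd⟩) s 0
  set G : ℝ → ℂ := fun t ↦ g t - c * ((t : ℂ) ^ (-(k : ℂ)) * g t⁻¹) with hG
  have hdG {t : ℝ} (ht : t ∈ Ioo (0 : ℝ) 1) : d t = G t := by
    have h1 : 1 < t⁻¹ := (one_lt_inv₀ ht.1).2 ht.2
    simp [hd, hr, hG, hp0 t ht.2, hp1 _ h1]
  have hcont : ContinuousAt d x := by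
    have h1 : ContinuousAt g x := hgc.continuousAt (Ioi_mem_nhds hx)
    have h2 : ContinuousAt (fun t : ℝ ↦ g t⁻¹) x :=
      ContinuousAt.comp (f := fun t : ℝ ↦ t⁻¹) (hgc.continuousAt (Ioi_mem_nhds (inv_pos.2 hx)))
        (continuousAt_inv₀ hx.ne')
    have h3 : ContinuousAt (fun t : ℝ ↦ (t : ℂ) ^ (-(k : ℂ))) x :=
      continuousAt_ofReal_cpow_const _ _ (Or.inr hx.ne')
    have h4 : ContinuousAt G x := h1.sub (continuousAt_const.mul (h3.mul h2))
    exact h4.congr (by filter_upwards [Ioo_mem_nhds hx hx1] with t ht using (hdG ht).symm)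
  have hdx : d x = 0 := eq_zero_of_mellin_eq_const (fun s hs ↦ (hdmellin hs).1)
    (fun s hs ↦ (hdmellin hs).2.trans (hEconst s)) hx hx1.ne hcont
  exact sub_eq_zero.1 ((hdG ⟨hx, hx1⟩).symm.trans hdx)

end MellinRigidity

section QSeries

open Set

/-- The `q`-series `Σ_{n ≥ 1} a_n e^{2πinz}` as a function of a complex variable. -/
noncomputable def qSeries (a : ℕ → ℂ) (z : ℂ) : ℂ :=
  ∑' n : ℕ, a (n + 1) * Complex.exp (2 * (Real.pi : ℂ) * Complex.I * ((n : ℂ) + 1) * z)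

theorem fourierSeries_apply (a : ℕ → ℂ) (z : ℍ) : fourierSeries a z = qSeries a z := rfl

theorem exp_neg_le_mul_rpow {b : ℝ} (hb : 0 < b) {x : ℝ} (hx : 0 < x) :
    Real.exp (-x) ≤ b ^ b * x ^ (-b) := by
  have h1 : (x / b) ^ b ≤ Real.exp x := by
    calc (x / b) ^ b ≤ Real.exp (x / b) ^ b := by
          gcongr
          linarith [Real.add_one_le_exp (x / b)]
      _ = Real.exp x := by rw [← Real.exp_mul, div_mul_cancel₀ _ hb.ne']
  rw [Real.div_rpow hx.le hb.le, div_le_iff₀ (by positivity)] at h1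
  rw [Real.exp_neg, Real.rpow_neg hx.le, ← div_eq_mul_inv, inv_eq_one_div,
    div_le_div_iff₀ (Real.exp_pos x) (by positivity)]
  linarith

theorem exists_norm_le_mul_rpow {a : ℕ → ℂ} {C : ℝ}
    (ha : (fun n : ℕ ↦ a n) =O[atTop] fun n : ℕ ↦ (n : ℝ) ^ C) :
    ∃ A, 0 ≤ A ∧ ∀ n : ℕ, ‖a (n + 1)‖ ≤ A * ((n : ℝ) + 1) ^ C := by
  have h := ha.comp_tendsto (tendsto_add_atTop_nat 1)
  have h2 : (fun n : ℕ ↦ a (n + 1)) =O[cofinite] fun n : ℕ ↦ ((n : ℝ) + 1) ^ C := by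
    rw [Nat.cofinite_eq_atTop]
    simpa [Function.comp_def] using h
  obtain ⟨A, hA, hb⟩ := bound_of_isBigO_cofinite h2
  refine ⟨A, hA.le, fun n ↦ ?_⟩
  have := hb (x := n) (by positivity)
  rwa [Real.norm_of_nonneg (by positivity)] at this

theorem exists_norm_qSeries_term_le {a : ℕ → ℂ} {C : ℝ} (hC : 0 < C)
    (ha : (fun n : ℕ ↦ a n) =O[atTop] fun n : ℕ ↦ (n : ℝ) ^ C) :
    ∃ K, 0 ≤ K ∧ ∀ (n : ℕ) (z : ℂ) (y : ℝ), 0 < y → y ≤ z.im →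
      ‖a (n + 1) * Complex.exp (2 * (Real.pi : ℂ) * Complex.I * ((n : ℂ) + 1) * z)‖ ≤
        K * (Real.exp (-Real.pi * y) * y ^ (-(C + 2))) * (((n : ℝ) + 1) ^ (2 : ℝ))⁻¹ := by
  obtain ⟨A, hA, hb⟩ := exists_norm_le_mul_rpow ha
  refine ⟨A * ((C + 2) ^ (C + 2) * Real.pi ^ (-(C + 2))), by positivity, fun n z y hy hyz ↦ ?_⟩
  have hn : (0 : ℝ) < n + 1 := by positivity
  have hexp : ‖Complex.exp (2 * (Real.pi : ℂ) * Complex.I * ((n : ℂ) + 1) * z)‖ ≤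
      Real.exp (-Real.pi * y) * Real.exp (-(Real.pi * (n + 1) * y)) := by
    have hre : (2 * (Real.pi : ℂ) * Complex.I * ((n : ℂ) + 1) * z).re =
        -(2 * Real.pi * (n + 1) * z.im) := by
      simp
    rw [Complex.norm_exp, hre, ← Real.exp_add]
    gcongr
    have h1 : 2 * Real.pi * (n + 1) * y ≤ 2 * Real.pi * (n + 1) * z.im := by gcongr
    have h2 : 0 ≤ Real.pi * n * y := by positivity
    linarith
  have hpow := exp_neg_le_mul_rpow (b := C + 2) (by linarith)
    (x := Real.pi * (n + 1) * y) (by positivity)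
  have hsplit : ((n : ℝ) + 1) ^ (-(C + 2)) =
      (((n : ℝ) + 1) ^ C)⁻¹ * (((n : ℝ) + 1) ^ (2 : ℝ))⁻¹ := by
    rw [← Real.rpow_neg hn.le, ← Real.rpow_neg hn.le, ← Real.rpow_add hn]
    ring_nf
  rw [Real.mul_rpow (by positivity) hy.le, Real.mul_rpow Real.pi_pos.le hn.le, hsplit] at hpow
  rw [norm_mul]
  calc _ ≤ A * ((n : ℝ) + 1) ^ C * (Real.exp (-Real.pi * y) * ((C + 2) ^ (C + 2) *
        (Real.pi ^ (-(C + 2)) * ((((n : ℝ) + 1) ^ C)⁻¹ * (((n : ℝ) + 1) ^ (2 : ℝ))⁻¹) *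
          y ^ (-(C + 2))))) := by
        gcongr
        · exact hb n
        · exact hexp.trans (by gcongr)
    _ = _ := by
        have : ((n : ℝ) + 1) ^ C ≠ 0 := by positivity
        field_simp

theorem summable_inv_succ_rpow_two : Summable fun n : ℕ ↦ (((n : ℝ) + 1) ^ (2 : ℝ))⁻¹ := by
  have := (summable_nat_add_iff 1).2 (Real.summable_nat_rpow_inv.2 one_lt_two)
  simpa using this

theorem summable_qSeries_term {a : ℕ → ℂ} {C : ℝ} (hC : 0 < C)
    (ha : (fun n : ℕ ↦ a n) =O[atTop] fun n : ℕ ↦ (n : ℝ) ^ C) {z : ℂ} (hz : 0 < z.im) :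
    Summable fun n : ℕ ↦
      a (n + 1) * Complex.exp (2 * (Real.pi : ℂ) * Complex.I * ((n : ℂ) + 1) * z) := by
  obtain ⟨K, -, hK⟩ := exists_norm_qSeries_term_le hC ha
  exact .of_norm_bounded (summable_inv_succ_rpow_two.mul_left _) fun n ↦ hK n z z.im hz le_rfl

theorem exists_norm_qSeries_le {a : ℕ → ℂ} {C : ℝ} (hC : 0 < C)
    (ha : (fun n : ℕ ↦ a n) =O[atTop] fun n : ℕ ↦ (n : ℝ) ^ C) :
    ∃ K, 0 ≤ K ∧ ∀ z : ℂ, 0 < z.im →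
      ‖qSeries a z‖ ≤ K * (Real.exp (-Real.pi * z.im) * z.im ^ (-(C + 2))) := by
  obtain ⟨K, hK0, hK⟩ := exists_norm_qSeries_term_le hC ha
  refine ⟨K * ∑' n : ℕ, (((n : ℝ) + 1) ^ (2 : ℝ))⁻¹,
    mul_nonneg hK0 (tsum_nonneg fun n ↦ by positivity), fun z hz ↦ ?_⟩
  refine (tsum_of_norm_bounded (summable_inv_succ_rpow_two.mul_left _).hasSum
    fun n ↦ hK n z z.im hz le_rfl).trans_eq ?_
  rw [tsum_mul_left]
  ring

theorem differentiableOn_qSeries {a : ℕ → ℂ} {C : ℝ} (hC : 0 < C)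
    (ha : (fun n : ℕ ↦ a n) =O[atTop] fun n : ℕ ↦ (n : ℝ) ^ C) :
    DifferentiableOn ℂ (qSeries a) {z | 0 < z.im} := by
  obtain ⟨K, -, hK⟩ := exists_norm_qSeries_term_le hC ha
  intro z (hz : 0 < z.im)
  have hopen : IsOpen {w : ℂ | z.im / 2 < w.im} := isOpen_lt continuous_const continuous_im
  have := differentiableOn_tsum_of_summable_norm (summable_inv_succ_rpow_two.mul_left _)
    (fun n ↦ by fun_prop) hopen
    fun n w (hw : z.im / 2 < w.im) ↦ hK n w (z.im / 2) (by positivity) hw.le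
  exact (this.differentiableAt (hopen.mem_nhds (half_lt_self hz))).differentiableWithinAt

theorem qSeries_add_one (a : ℕ → ℂ) (z : ℂ) : qSeries a (z + 1) = qSeries a z := by
  refine tsum_congr fun n ↦ ?_
  have : 2 * (Real.pi : ℂ) * Complex.I * ((n : ℂ) + 1) * (z + 1) =
      2 * (Real.pi : ℂ) * Complex.I * ((n : ℂ) + 1) * z +
        ((n + 1 : ℕ) : ℂ) * (2 * Real.pi * Complex.I) := by
    push_cast; ring
  rw [this, Complex.exp_add, Complex.exp_nat_mul_two_pi_mul_I, mul_one]

/-- The Mellin transform of the restriction of a `q`-series to the imaginary axis. -/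
theorem mellin_qSeries {a : ℕ → ℂ} {C : ℝ} (hC : 0 < C)
    (ha : (fun n : ℕ ↦ a n) =O[atTop] fun n : ℕ ↦ (n : ℝ) ^ C) {r : ℝ} (hr : 0 < r) {s : ℂ}
    (hs : C + 2 < s.re) :
    mellin (fun t : ℝ ↦ qSeries a (t / r * Complex.I)) s =
      ((r : ℂ) / (2 * (Real.pi : ℂ))) ^ s * Complex.Gamma s * dirichletSeries a s := by
  have hpi := Real.pi_pos
  have hsum := hasSum_mellin (a := fun n : ℕ ↦ a (n + 1)) (s := s)
    (p := fun n : ℕ ↦ 2 * Real.pi * (n + 1) / r) (F := fun t : ℝ ↦ qSeries a (t / r * Complex.I))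
    (fun n ↦ .inr (by positivity)) (by linarith) ?_ ?_
  · rw [← hsum.tsum_eq, dirichletSeries, ← tsum_mul_left]
    refine tsum_congr fun n ↦ ?_
    have h1 : ((2 * Real.pi * (n + 1) / r : ℝ) : ℂ) =
        ((n + 1 : ℝ) : ℂ) / ((r / (2 * Real.pi) : ℝ) : ℂ) := by
      rw [← ofReal_div]; congr 1; field_simp
    rw [h1, div_cpow_ofReal_nonneg (by positivity) (by positivity)]
    push_cast
    have h2 : ((r : ℂ) / (2 * (Real.pi : ℂ))) ^ s ≠ 0 := by
      rw [Ne, cpow_eq_zero_iff]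
      have : (r : ℂ) / (2 * (Real.pi : ℂ)) ≠ 0 := by
        exact_mod_cast (by positivity : r / (2 * Real.pi) ≠ 0)
      tauto
    rw [div_div_eq_mul_div]
    ring
  · intro t (ht : 0 < t)
    have hz : 0 < ((t : ℂ) / r * Complex.I).im := by
      rw [← ofReal_div]; simpa using div_pos ht hr
    convert (summable_qSeries_term hC ha hz).hasSum using 2 with n
    · congr 1
      push_cast
      congr 1
      linear_combination (-(2 * Real.pi * (n + 1) * t / r) : ℂ) * Complex.I_sq
    · rfl
  · obtain ⟨A, hA, hb⟩ := exists_norm_le_mul_rpow ha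
    refine .of_nonneg_of_le (fun n ↦ by positivity) (fun n ↦ ?_)
      (summable_inv_succ_rpow_two.mul_left (A * ((2 * Real.pi / r) ^ s.re)⁻¹))
    have hn : (1 : ℝ) ≤ n + 1 := by simp
    have h1 : 2 * Real.pi * (n + 1) / r = (2 * Real.pi / r) * (n + 1) := by ring
    rw [h1, Real.mul_rpow (by positivity) (by positivity), div_le_iff₀ (by positivity)]
    have h2 : ((n : ℝ) + 1) ^ C * ((n : ℝ) + 1) ^ (2 : ℝ) ≤ ((n : ℝ) + 1) ^ s.re := by
      rw [← Real.rpow_add (by positivity)]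
      exact Real.rpow_le_rpow_of_exponent_le hn hs.le
    calc ‖a (n + 1)‖ ≤ A * ((n : ℝ) + 1) ^ C := hb n
      _ = A * (((n : ℝ) + 1) ^ C * ((n : ℝ) + 1) ^ (2 : ℝ)) * (((n : ℝ) + 1) ^ (2 : ℝ))⁻¹ := by
          field_simp
      _ ≤ A * ((n : ℝ) + 1) ^ s.re * (((n : ℝ) + 1) ^ (2 : ℝ))⁻¹ := by gcongr
      _ = _ := by
          field_simp

end QSeries

section FunctionalEquation

open Set

theorem im_ofReal_div_mul_I (t r : ℝ) : ((t : ℂ) / r * Complex.I).im = t / r := by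
  rw [← ofReal_div]; simp

theorem isBigO_atTop_qSeries {a : ℕ → ℂ} {C : ℝ} (hC : 0 < C)
    (ha : (fun n : ℕ ↦ a n) =O[atTop] fun n : ℕ ↦ (n : ℝ) ^ C) {r : ℝ} (hr : 0 < r) :
    (fun t : ℝ ↦ qSeries a (t / r * Complex.I)) =O[atTop]
      fun t ↦ Real.exp (-(Real.pi / r) * t) := by
  obtain ⟨K, hK0, hK⟩ := exists_norm_qSeries_le hC ha
  refine .of_bound K ?_
  filter_upwards [eventually_ge_atTop r] with t ht
  have ht0 : 0 < t / r := div_pos (hr.trans_le ht) hr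
  refine (hK _ (by rwa [im_ofReal_div_mul_I])).trans ?_
  rw [im_ofReal_div_mul_I, Real.norm_of_nonneg (Real.exp_pos _).le]
  have h1 : (t / r) ^ (-(C + 2)) ≤ 1 :=
    Real.rpow_le_one_of_one_le_of_nonpos ((one_le_div hr).2 ht) (by linarith)
  have h2 : -Real.pi * (t / r) = -(Real.pi / r) * t := by ring
  rw [h2]
  gcongr
  exact mul_le_of_le_one_right (Real.exp_pos _).le h1

theorem isBigO_nhdsGT_zero_qSeries {a : ℕ → ℂ} {C : ℝ} (hC : 0 < C)
    (ha : (fun n : ℕ ↦ a n) =O[atTop] fun n : ℕ ↦ (n : ℝ) ^ C) {r : ℝ} (hr : 0 < r) :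
    (fun t : ℝ ↦ qSeries a (t / r * Complex.I)) =O[𝓝[>] 0] fun t : ℝ ↦ t ^ (-(C + 2)) := by
  obtain ⟨K, hK0, hK⟩ := exists_norm_qSeries_le hC ha
  refine .of_bound (K * (r ^ (-(C + 2)))⁻¹) ?_
  filter_upwards [self_mem_nhdsWithin] with t (ht : 0 < t)
  have ht0 : 0 < t / r := div_pos ht hr
  refine (hK _ (by rwa [im_ofReal_div_mul_I])).trans ?_
  rw [im_ofReal_div_mul_I, Real.norm_of_nonneg (by positivity), Real.div_rpow ht.le hr.le,
    mul_assoc, inv_mul_eq_div]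
  gcongr
  refine mul_le_of_le_one_left (by positivity) (Real.exp_le_one_iff.2 ?_)
  have := mul_pos Real.pi_pos ht0
  linarith

theorem continuousOn_qSeries_imaginary_axis {a : ℕ → ℂ} {C : ℝ} (hC : 0 < C)
    (ha : (fun n : ℕ ↦ a n) =O[atTop] fun n : ℕ ↦ (n : ℝ) ^ C) {r : ℝ} (hr : 0 < r) :
    ContinuousOn (fun t : ℝ ↦ qSeries a (t / r * Complex.I)) (Ioi 0) := by
  refine (differentiableOn_qSeries hC ha).continuousOn.comp (by fun_prop) fun t ht ↦ ?_
  simpa only [mem_ofPred_eq, im_ofReal_div_mul_I] using div_pos ht hr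

theorem im_neg_one_div_mul_pos {N : ℝ} (hN : 0 < N) {z : ℂ} (hz : 0 < z.im) :
    0 < (-1 / (N * z)).im := by
  have hz0 : z ≠ 0 := fun h ↦ by simp [h] at hz
  have h : (-1 / (N * z)).im = z.im / (N * normSq z) := by
    have hn : normSq z ≠ 0 := (normSq_pos.2 hz0).ne'
    simp [div_im, normSq_mul]
    field_simp
  rw [h]
  exact div_pos hz (mul_pos hN (normSq_pos.2 hz0))

/-- An analytic identity on the imaginary axis extends the modular relation under
`z ↦ -1 / (N z)` to the whole upper half-plane. -/
theorem eq_of_eq_on_imaginary_axis {f : ℂ → ℂ} (hf : DifferentiableOn ℂ f {z | 0 < z.im})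
    {N : ℝ} (hN : 0 < N) {k : ℤ} {b : ℂ} {r : ℝ} (hr : 0 < r)
    (h : ∀ t : ℝ, 0 < t → t < 1 → f (-1 / (N * (t / r * Complex.I))) =
      b * (t / r * Complex.I) ^ k * f (t / r * Complex.I))
    {z : ℂ} (hz : 0 < z.im) : f (-1 / (N * z)) = b * z ^ k * f z := by
  have hU : IsOpen {z : ℂ | 0 < z.im} := isOpen_lt continuous_const continuous_im
  have hne {w : ℂ} (hw : 0 < w.im) : w ≠ 0 := fun h ↦ by simp [h] at hw
  have hNc : (N : ℂ) ≠ 0 := by exact_mod_cast hN.ne'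
  have hl : AnalyticOnNhd ℂ (fun w ↦ f (-1 / (N * w))) {z | 0 < z.im} := by
    refine DifferentiableOn.analyticOnNhd (hf.comp ?_ fun w hw ↦ im_neg_one_div_mul_pos hN hw) hU
    exact (differentiableOn_const _).div (by fun_prop) fun w hw ↦ mul_ne_zero hNc (hne hw)
  have hrhs : AnalyticOnNhd ℂ (fun w ↦ b * w ^ k * f w) {z | 0 < z.im} := by
    refine DifferentiableOn.analyticOnNhd (DifferentiableOn.mul ?_ hf) hU
    exact fun w hw ↦ ((differentiableAt_zpow.2 (.inl (hne hw))).const_mul b).differentiableWithinAt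
  have him (t : ℝ) : ((t : ℂ) / r * Complex.I).im = t / r := im_ofReal_div_mul_I t r
  have htend : Tendsto (fun t : ℝ ↦ (t : ℂ) / r * Complex.I) (𝓝[≠] (1 / 2))
      (𝓝[≠] (((1 / 2 : ℝ) : ℂ) / r * Complex.I)) := by
    refine tendsto_nhdsWithin_iff.2 ⟨?_, ?_⟩
    · exact Continuous.tendsto (f := fun t : ℝ ↦ (t : ℂ) / r * Complex.I) (by fun_prop) _ |>.mono_left
        nhdsWithin_le_nhds
    · filter_upwards [self_mem_nhdsWithin] with t ht heq
      have := congrArg Complex.im heq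
      rw [him, him, div_left_inj' hr.ne'] at this
      exact ht this
  refine hl.eqOn_of_preconnected_of_frequently_eq hrhs
    (convex_halfSpace_im_gt 0).isPreconnected
    (z₀ := ((1 / 2 : ℝ) : ℂ) / r * Complex.I) ?_ ?_ hz
  · simp only [mem_ofPred_eq, him]; positivity
  · refine htend.frequently (Eventually.frequently ?_)
    filter_upwards [mem_nhdsWithin_of_mem_nhds (Ioo_mem_nhds (by norm_num : (0 : ℝ) < 1 / 2)
      (by norm_num : (1 / 2 : ℝ) < 1))] with t ht using h t ht.1 ht.2

theorem coe_glAct {γ : Matrix (Fin 2) (Fin 2) ℝ} (h : 0 < γ.det) (z : ℍ) :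
    (glAct γ z : ℂ) = (γ 0 0 * z + γ 0 1) / (γ 1 0 * z + γ 1 1) := by
  rw [glAct, dif_pos h]
  exact coe_smul_of_det_pos (g := Matrix.GeneralLinearGroup.mkOfDetNeZero γ h.ne') h z

/-- Hecke's converse theorem for the involution `z ↦ -1 / (N z)`. -/
theorem qSeries_neg_one_div {N : ℕ} (hN : 1 ≤ N) {m : ℤ} {a : ℕ → ℂ} {C : ℝ} (hC : 0 < C)
    (ha : (fun n : ℕ ↦ a n) =O[atTop] fun n : ℕ ↦ (n : ℝ) ^ C) {ε : ℝ} (hε : ε = 1 ∨ ε = -1)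
    {Φ : ℂ → ℂ} (hΦ : Differentiable ℂ Φ)
    (hΦeq : ∀ s : ℂ, C + 2 < s.re →
      Φ s = ((Real.sqrt N : ℂ) / (2 * (Real.pi : ℂ))) ^ s * Complex.Gamma s *
        dirichletSeries a s)
    (hΦbdd : ∀ σ₁ σ₂ : ℝ, ∃ M : ℝ, ∀ s : ℂ, σ₁ ≤ s.re → s.re ≤ σ₂ → ‖Φ s‖ ≤ M)
    (hΦfe : ∀ s : ℂ, Φ s = (ε : ℂ) * (-1 : ℂ) ^ m * Φ (((m + m : ℤ) : ℂ) - s))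
    {z : ℂ} (hz : 0 < z.im) :
    qSeries a (-1 / ((N : ℝ) * z)) = (ε * (N : ℂ) ^ m) * z ^ (m + m) * qSeries a z := by
  have hN0 : (0 : ℝ) < N := by exact_mod_cast hN
  have hr : 0 < Real.sqrt N := Real.sqrt_pos.2 hN0
  refine eq_of_eq_on_imaginary_axis (differentiableOn_qSeries hC ha) hN0 hr (fun t ht ht1 ↦ ?_) hz
  have hε2 : (ε : ℂ) * ε = 1 := by rcases hε with rfl | rfl <;> simp
  have hm2 : (-1 : ℂ) ^ m * (-1) ^ m = 1 := by rw [← mul_zpow]; simp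
  have hc : ((ε : ℂ) * (-1) ^ m) * ((ε : ℂ) * (-1) ^ m) = 1 := by
    linear_combination (-1 : ℂ) ^ m * (-1) ^ m * hε2 + hm2
  have key := eq_cpow_mul_inv_of_mellin_functional_equation
    (continuousOn_qSeries_imaginary_axis hC ha hr) (div_pos Real.pi_pos hr)
    (isBigO_atTop_qSeries hC ha hr)
    (fun s hs ↦ mellinConvergent_of_isBigO_rpow_exp (div_pos Real.pi_pos hr)
      ((continuousOn_qSeries_imaginary_axis hC ha hr).locallyIntegrableOn measurableSet_Ioi)
      (isBigO_atTop_qSeries hC ha hr) (isBigO_nhdsGT_zero_qSeries hC ha hr) hs)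
    hΦ (fun s hs ↦ (mellin_qSeries hC ha hr hs).trans (hΦeq s hs).symm) hΦbdd hc
    (k := ((m + m : ℤ) : ℝ)) (by simpa using hΦfe) ht ht1
  have ht0 : (t : ℂ) ≠ 0 := by exact_mod_cast ht.ne'
  have hr0 : (Real.sqrt N : ℂ) ≠ 0 := by exact_mod_cast hr.ne'
  have hrr : (Real.sqrt N : ℂ) * Real.sqrt N = N := by
    exact_mod_cast Real.mul_self_sqrt hN0.le
  have hpt : -1 / (((N : ℝ) : ℂ) * (t / Real.sqrt N * Complex.I)) =
      (t⁻¹ : ℝ) / Real.sqrt N * Complex.I := by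
    rw [ofReal_natCast, ← hrr]
    push_cast
    field_simp
    simp
  have hpow : ((N : ℂ)) ^ m * ((t : ℂ) / Real.sqrt N * Complex.I) ^ (m + m) =
      (-1) ^ m * (t : ℂ) ^ (m + m) := by
    have h1 : (N : ℂ) * ((t / Real.sqrt N * Complex.I) * (t / Real.sqrt N * Complex.I)) =
        -1 * (t * t) := by
      rw [← hrr]
      field_simp
      simp
    rw [zpow_add₀ (by simp [ht0, hr0]), zpow_add₀ ht0, ← mul_zpow, ← mul_zpow, h1, mul_zpow,
      mul_zpow]
  have hcpow : (t : ℂ) ^ (-(((m + m : ℤ) : ℝ) : ℂ)) = ((t : ℂ) ^ (m + m))⁻¹ := by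
    rw [cpow_neg, ofReal_intCast, cpow_intCast]
  have htk : (t : ℂ) ^ (m + m) ≠ 0 := zpow_ne_zero _ ht0
  rw [hcpow] at key
  rw [hpt, mul_assoc (ε : ℂ), hpow, key]
  generalize qSeries a ((t⁻¹ : ℝ) / Real.sqrt N * Complex.I) = u
  field_simp
  linear_combination (-u) * hc

end FunctionalEquation

/-- **Lemma 1, functional equation part.** A functional equation of degree 2,
level `N`, and weight `k` for `F(s)` implies `f|_k P = f`, `f|_k H_N = ε f`,
and consequently `f|_k W_N = f`. -/
theorem lemma_one_functional_equation_part
    (N : ℕ) (hN : 1 ≤ N)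
    (k : ℤ) (hkpos : 0 < k) (hkeven : Even k)
    (a : ℕ → ℂ) (C : ℝ) (hC : 0 < C)
    (hgrowth : (fun n : ℕ => a n) =O[atTop] fun n : ℕ => (n : ℝ) ^ C)
    (ε : ℝ) (hε : ε = 1 ∨ ε = -1)
    (Φ : ℂ → ℂ)
    (hΦentire : Differentiable ℂ Φ)
    (hΦeq : ∀ s : ℂ, C + 2 < s.re →
      Φ s = ((Real.sqrt N : ℂ) / (2 * (Real.pi : ℂ))) ^ s * Complex.Gamma s *
        dirichletSeries a s)
    (hΦbdd : ∀ σ₁ σ₂ : ℝ, ∃ M : ℝ, ∀ s : ℂ, σ₁ ≤ s.re → s.re ≤ σ₂ → ‖Φ s‖ ≤ M)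
    (hΦfe : ∀ s : ℂ, Φ s = (ε : ℂ) * (-1 : ℂ) ^ (k / 2) * Φ ((k : ℂ) - s)) :
    slash k !![1, 1; 0, 1] (fourierSeries a) = fourierSeries a ∧
    slash k !![0, -1; (N : ℝ), 0] (fourierSeries a)
      = (fun z => (ε : ℂ) * fourierSeries a z) ∧
    slash k !![1, 0; (N : ℝ), 1] (fourierSeries a) = fourierSeries a := by
  obtain ⟨m, rfl⟩ := hkeven
  have hm : (m + m) / 2 = m := by omega
  rw [hm] at hΦfe
  have hN0 : (0 : ℝ) < N := by exact_mod_cast hN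
  have hNc : (N : ℂ) ≠ 0 := by exact_mod_cast hN0.ne'
  have hinv {z : ℂ} (hz : 0 < z.im) :=
    qSeries_neg_one_div hN hC hgrowth hε hΦentire hΦeq hΦbdd hΦfe hz
  have hε0 : (ε : ℂ) ≠ 0 := by rcases hε with rfl | rfl <;> simp
  refine ⟨?_, ?_, ?_⟩
  · ext z
    simp [slash, fourierSeries_apply, coe_glAct, det_fin_two, qSeries_add_one]
  · ext z
    have hz0 : (z : ℂ) ≠ 0 := ne_zero z
    have hdet : 0 < (!![0, -1; (N : ℝ), 0]).det := by simpa [det_fin_two] using hN0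
    rw [slash, fourierSeries_apply, fourierSeries_apply, coe_glAct hdet]
    have := hinv z.im_pos
    simp only [ofReal_natCast] at this
    simp only [det_fin_two, hm]
    simp [this]
    simp only [zpow_add₀ (mul_ne_zero hNc hz0), zpow_add₀ hz0, mul_zpow, _root_.zpow_neg]
    field_simp
  · ext z
    have hz0 : (z : ℂ) ≠ 0 := ne_zero z
    have hdet : 0 < (!![1, 0; (N : ℝ), 1]).det := by simp [det_fin_two]
    have hw := hinv (glAct !![1, 0; (N : ℝ), 1] z).im_pos
    have hz := hinv z.im_pos
    have hcoe : (glAct !![1, 0; (N : ℝ), 1] z : ℂ) = z / (N * z + 1) := by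
      rw [coe_glAct hdet]; simp
    have hden : (N : ℂ) * z + 1 ≠ 0 := fun h ↦
      ne_zero (glAct !![1, 0; (N : ℝ), 1] z) (by rw [hcoe, h, div_zero])
    have hpt : -1 / ((N : ℝ) * (z : ℂ)) =
        -1 / ((N : ℝ) * (glAct !![1, 0; (N : ℝ), 1] z : ℂ)) + 1 := by
      rw [hcoe, ofReal_natCast]
      field_simp
      ring
    rw [hpt, qSeries_add_one, hw, hcoe, mul_assoc ((ε : ℂ) * (N : ℂ) ^ m),
      mul_assoc ((ε : ℂ) * (N : ℂ) ^ m)] at hz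
    have h := mul_left_cancel₀ (mul_ne_zero hε0 (zpow_ne_zero m hNc)) hz
    rw [div_zpow, div_mul_eq_mul_div, mul_div_assoc] at h
    have h' := mul_left_cancel₀ (zpow_ne_zero (m + m) hz0) h
    rw [slash, fourierSeries_apply, fourierSeries_apply, hcoe, ← h', _root_.zpow_neg]
    simp [det_fin_two]
    ring
end

section
/- Let N, n be positive integers, k a positive even integer, f : ℍ → ℂ, and ε ∈ {+1,−1}. Suppose f|_k P = f, f|_k H_N = ε f, and for each prime p dividing n there is α_p ∈ ℂ with f|_k T_p = α_p f. Then f|_k (H_N R_n H_{n²N}) = f|_k R_n; explicitly, Σ_{1≤a≤n, gcd(a,n)=1} f|_k ( H_N · ((n,a),(0,n)) · H_{n²N} ) = Σ_{1≤a≤n, gcd(a,n)=1} f|_k ((n,a),(0,n)). (Theorem 2.) -/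
open UpperHalfPlane Matrix Complex MatrixGroups Asymptotics Filter Topology
open scoped Manifold

section Slash

variable {k : ℤ} {A B : Matrix (Fin 2) (Fin 2) ℝ}

lemma coe_glAct_s8 (hA : 0 < A.det) (z : ℍ) :
    (glAct A z : ℂ) = (A 0 0 * z + A 0 1) / (A 1 0 * z + A 1 1) := by
  rw [glAct, dif_pos hA]
  erw [UpperHalfPlane.coe_smul_of_det_pos (by simpa [Matrix.GeneralLinearGroup.mkOfDetNeZero] using hA)]
  rfl

lemma slash_denom_ne_zero (hA : 0 < A.det) (z : ℍ) : (A 1 0 * z + A 1 1 : ℂ) ≠ 0 := by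
  intro h
  have him := congrArg Complex.im h
  have hre := congrArg Complex.re h
  simp only [add_im, mul_im, ofReal_re, ofReal_im, zero_mul, add_zero, zero_im, add_re, mul_re,
    sub_zero, zero_re, coe_im, coe_re] at him hre
  have h10 : A 1 0 = 0 := (mul_eq_zero.mp him).resolve_right z.im_pos.ne'
  have h11 : A 1 1 = 0 := by simpa [h10] using hre
  simp [Matrix.det_fin_two, h10, h11] at hA

lemma glAct_mul (hA : 0 < A.det) (hB : 0 < B.det) (z : ℍ) :
    glAct (A * B) z = glAct A (glAct B z) := by
  have hAB : 0 < (A * B).det := by rw [Matrix.det_mul]; positivity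
  have h1 := slash_denom_ne_zero hB z
  have h2 := slash_denom_ne_zero hAB z
  have h3 := slash_denom_ne_zero hA (glAct B z)
  apply UpperHalfPlane.ext
  rw [coe_glAct_s8 hB] at h3
  rw [coe_glAct_s8 hAB, coe_glAct_s8 hA, coe_glAct_s8 hB]
  rw [div_eq_div_iff h2 h3]
  simp only [Matrix.mul_apply, Fin.sum_univ_two, ofReal_add, ofReal_mul] at h2 ⊢
  field_simp
  ring

lemma slash_mul (hA : 0 < A.det) (hB : 0 < B.det) (f : ℍ → ℂ) :
    slash k (A * B) f = slash k B (slash k A f) := by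
  funext z
  have h1 := slash_denom_ne_zero hB z
  have hden : (((A * B) 1 0 : ℝ) * z + ((A * B) 1 1 : ℝ) : ℂ) =
      (A 1 0 * (glAct B z : ℂ) + A 1 1) * (B 1 0 * z + B 1 1) := by
    rw [coe_glAct_s8 hB]
    simp only [Matrix.mul_apply, Fin.sum_univ_two, ofReal_add, ofReal_mul]
    field_simp
    ring
  simp only [slash]
  rw [hden, glAct_mul hA hB, Matrix.det_mul, ofReal_mul, mul_zpow, mul_zpow]
  ring

lemma slash_smul_matrix (hk : Even k) {c : ℝ} (hc : 0 < c) (hA : 0 < A.det) (f : ℍ → ℂ) :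
    slash k (c • A) f = slash k A f := by
  funext z
  have hcA : 0 < (c • A).det := by rw [Matrix.det_smul]; positivity
  have hc' : (c : ℂ) ≠ 0 := ofReal_ne_zero.mpr hc.ne'
  have hact : glAct (c • A) z = glAct A z := by
    apply UpperHalfPlane.ext
    rw [coe_glAct_s8 hcA, coe_glAct_s8 hA]
    simp only [Matrix.smul_apply, smul_eq_mul, ofReal_mul, mul_assoc, ← mul_add]
    rw [mul_div_mul_left _ _ hc']
  obtain ⟨j, rfl⟩ := hk
  have hj : (j + j) / 2 = j := by omega
  simp only [slash]
  rw [hact, Matrix.det_smul, hj]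
  simp only [Matrix.smul_apply, smul_eq_mul, ofReal_mul, mul_assoc, ← mul_add, Fintype.card_fin,
    ofReal_pow]
  rw [mul_zpow, mul_zpow, ← zpow_natCast, ← _root_.zpow_mul]
  have : (c : ℂ) ^ (((2 : ℕ) : ℤ) * j) * (c : ℂ) ^ (-(j + j)) = 1 := by
    rw [← zpow_add₀ hc']
    convert zpow_zero _
    push_cast
    ring
  linear_combination ((A.det : ℂ) ^ j * (A 1 0 * z + A 1 1 : ℂ) ^ (-(j + j)) * f (glAct A z)) * this

lemma slash_one (f : ℍ → ℂ) : slash k 1 f = f := by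
  funext z
  have : glAct 1 z = z := by
    apply UpperHalfPlane.ext
    rw [coe_glAct_s8 (by simp)]
    simp
  simp [slash, this]

/-- The weight-`k` slash action of a fixed matrix, as a linear map. -/
noncomputable def slashLinear (k : ℤ) (A : Matrix (Fin 2) (Fin 2) ℝ) :
    (ℍ → ℂ) →ₗ[ℂ] (ℍ → ℂ) where
  toFun := slash k A
  map_add' f g := by funext z; simp only [slash, Pi.add_apply]; ring
  map_smul' c f := by
    funext z
    simp only [slash, Pi.smul_apply, smul_eq_mul, RingHom.id_apply]
    ring

lemma slashLinear_apply (f : ℍ → ℂ) : slashLinear k A f = slash k A f := rfl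

end Slash

section CoprimeSum

variable {M : Type*} [AddCommGroup M] {m p : ℕ}

/-- The sum of `F` over the residues in `[0, m)` that are coprime to `m`. -/
def coprimeSum (m : ℕ) (F : ℕ → M) : M :=
  ∑ b ∈ (Finset.range m).filter (fun b => b.Coprime m), F b

lemma coprimeSum_congr {F G : ℕ → M} (h : ∀ b, F b = G b) : coprimeSum m F = coprimeSum m G := by
  rw [funext h]

lemma sum_Icc_coprime {F : ℕ → M} (hm : 0 < m) (hF : F.Periodic m) :
    ∑ b ∈ (Finset.Icc 1 m).filter (fun b => b.Coprime m), F b = coprimeSum m F := by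
  unfold coprimeSum
  rw [Finset.sum_filter, Finset.sum_filter, Finset.range_eq_Ico,
    Finset.sum_eq_sum_Ico_succ_bot hm, ← Finset.Ico_succ_right_eq_Icc]
  rw [Nat.succ_eq_succ, Nat.succ_eq_add_one, Finset.sum_Ico_succ_top (by omega), add_comm]
  have : F m = F 0 := by simpa using hF 0
  simp [this, Nat.coprime_self]

lemma sum_range_coprimeSum (hm : 0 < m) (F : ℕ → M) :
    ∑ β ∈ Finset.range p, coprimeSum m (fun b => F (b + β * m)) =
      ∑ c ∈ (Finset.range (p * m)).filter (fun c => c.Coprime m), F c := by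
  unfold coprimeSum
  rw [← Finset.sum_product']
  refine Finset.sum_nbij' (fun x => x.2 + x.1 * m) (fun c => (c / m, c % m)) ?_ ?_ ?_ ?_ ?_
  · rintro ⟨β, b⟩ h
    simp only [Finset.mem_product, Finset.mem_range, Finset.mem_filter] at h ⊢
    refine ⟨?_, by simpa using h.2.2⟩
    calc b + β * m < m + β * m := by omega
      _ = (β + 1) * m := by ring
      _ ≤ p * m := Nat.mul_le_mul_right _ h.1
  · intro c h
    simp only [Finset.mem_product, Finset.mem_range, Finset.mem_filter] at h ⊢
    refine ⟨(Nat.div_lt_iff_lt_mul hm).mpr h.1, Nat.mod_lt _ hm, ?_⟩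
    rw [Nat.Coprime, ← Nat.gcd_rec, Nat.gcd_comm]
    exact h.2
  · rintro ⟨β, b⟩ h
    simp only [Finset.mem_product, Finset.mem_range, Finset.mem_filter] at h
    simp [Nat.add_mul_div_right _ _ hm, Nat.div_eq_of_lt h.2.1, Nat.mod_eq_of_lt h.2.1]
  · intro c _
    simp [Nat.mod_add_div']
  · intro x _
    rfl

lemma sum_range_coprimeSum_of_dvd (hm : 0 < m) (hpm : p ∣ m) (F : ℕ → M) :
    ∑ β ∈ Finset.range p, coprimeSum m (fun b => F (b + β * m)) = coprimeSum (p * m) F := by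
  rw [sum_range_coprimeSum hm, coprimeSum]
  congr 1
  ext c
  simp only [Finset.mem_filter, Finset.mem_range, Nat.coprime_mul_iff_right, and_congr_right_iff]
  exact fun _ => ⟨fun h => ⟨h.coprime_dvd_right hpm, h⟩, fun h => h.2⟩

lemma sum_range_coprimeSum_of_not_dvd (hp : p.Prime) (hm : 0 < m) (hpm : ¬ p ∣ m) (F : ℕ → M) :
    ∑ β ∈ Finset.range p, coprimeSum m (fun b => F (b + β * m)) =
      coprimeSum (p * m) F + coprimeSum m (fun b => F (p * b)) := by
  rw [sum_range_coprimeSum hm, ← Finset.sum_filter_add_sum_filter_not _ (fun c => c.Coprime p)]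
  unfold coprimeSum
  congr 1
  · congr 1
    ext c
    simp only [Finset.mem_filter, Finset.mem_range, Nat.coprime_mul_iff_right]
    tauto
  · symm
    refine Finset.sum_nbij (fun b => p * b) ?_ ?_ ?_ ?_
    · intro b h
      simp only [Finset.mem_filter, Finset.mem_range] at h ⊢
      refine ⟨⟨Nat.mul_lt_mul_of_pos_left h.1 hp.pos, ?_⟩, ?_⟩
      · exact Nat.Coprime.mul_left ((Nat.Prime.coprime_iff_not_dvd hp).mpr hpm) h.2
      · rw [Nat.coprime_comm, hp.coprime_iff_not_dvd]
        simp
    · intro a _ b _ h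
      exact Nat.eq_of_mul_eq_mul_left hp.pos h
    · intro c h
      simp only [Finset.coe_filter, Finset.mem_filter, Finset.mem_range, Set.mem_ofPred_eq] at h
      obtain ⟨⟨h1, h2⟩, h3⟩ := h
      rw [Nat.coprime_comm, hp.coprime_iff_not_dvd, not_not] at h3
      obtain ⟨b, rfl⟩ := h3
      refine ⟨b, ?_, rfl⟩
      simp only [Finset.coe_filter, Finset.mem_range, Set.mem_ofPred_eq]
      exact ⟨lt_of_mul_lt_mul_left h1 (Nat.zero_le _), h2.coprime_mul_left⟩
    · intro b _
      rfl

lemma coprimeSum_mul_left {G : ℕ → M} (hpm : p.Coprime m) (hG : G.Periodic m) :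
    coprimeSum m (fun b => G (p * b)) = coprimeSum m G := by
  rcases Nat.eq_zero_or_pos m with rfl | hm
  · simp [coprimeSum]
  unfold coprimeSum
  have hmaps : ∀ b ∈ (Finset.range m).filter (fun b => b.Coprime m),
      p * b % m ∈ (Finset.range m).filter (fun b => b.Coprime m) := by
    intro b h
    simp only [Finset.mem_filter, Finset.mem_range] at h ⊢
    refine ⟨Nat.mod_lt _ hm, ?_⟩
    rw [Nat.Coprime, ← Nat.gcd_rec, Nat.gcd_comm]
    exact Nat.Coprime.mul_left hpm h.2
  have hinj : Set.InjOn (fun b => p * b % m) ((Finset.range m).filter (fun b => b.Coprime m)) := by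
    intro a ha b hb h
    simp only [Finset.coe_filter, Finset.mem_range, Set.mem_ofPred_eq] at ha hb
    have : a ≡ b [MOD m] := Nat.ModEq.cancel_left_of_coprime (by rwa [Nat.gcd_comm]) h
    exact this.eq_of_lt_of_lt ha.1 hb.1
  refine Finset.sum_nbij (fun b => p * b % m) hmaps hinj
    (Finset.surjOn_of_injOn_of_card_le _ hmaps hinj le_rfl) ?_
  intro b _
  exact (hG.map_mod_nat _).symm

lemma exists_coprimeSum_mul (hp : p.Prime) (hm : 0 < m) :
    ∃ c : ℤ, ∀ G : ℕ → M, G.Periodic m → coprimeSum (p * m) G = c • coprimeSum m G := by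
  have hconst : ∀ G : ℕ → M, G.Periodic m →
      ∑ β ∈ Finset.range p, coprimeSum m (fun b => G (b + β * m)) = p • coprimeSum m G := by
    intro G hG
    have : ∀ β b, G (b + β * m) = G b := fun β b => by simpa using hG.nsmul β b
    simp [this, coprimeSum]
  by_cases hpm : p ∣ m
  · refine ⟨p, fun G hG => ?_⟩
    rw [← sum_range_coprimeSum_of_dvd hm hpm, hconst G hG, natCast_zsmul]
  · refine ⟨p - 1, fun G hG => ?_⟩
    have h := sum_range_coprimeSum_of_not_dvd hp hm hpm G
    rw [hconst G hG, coprimeSum_mul_left (hp.coprime_iff_not_dvd.mpr hpm) hG] at h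
    rw [sub_smul, one_smul, natCast_zsmul, h, add_sub_cancel_right]

end CoprimeSum

section Twist

variable {k : ℤ} {f : ℍ → ℂ} {m p : ℕ}

/-- The sum of the functions `f|_k ((1,b),(0,m))` over the residues `b` coprime to `m`. -/
noncomputable def twistSum (k : ℤ) (f : ℍ → ℂ) (m : ℕ) : ℍ → ℂ :=
  coprimeSum m (fun b => slash k !![1, (b : ℝ); 0, (m : ℝ)] f)

lemma slash_coprimeSum (A : Matrix (Fin 2) (Fin 2) ℝ) (F : ℕ → ℍ → ℂ) :
    slash k A (coprimeSum m F) = coprimeSum m (fun b => slash k A (F b)) :=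
  map_sum (slashLinear k A) _ _

lemma slash_translate_periodic (hm : 0 < m) (hP : slash k !![1, 1; 0, 1] f = f) :
    Function.Periodic (fun b : ℕ => slash k !![1, (b : ℝ); 0, (m : ℝ)] f) m := by
  intro b
  have hm' : (0 : ℝ) < m := by exact_mod_cast hm
  have : !![1, ((b + m : ℕ) : ℝ); 0, (m : ℝ)] = !![1, 1; 0, 1] * !![1, (b : ℝ); 0, (m : ℝ)] := by
    simp
  simp only
  rw [this, slash_mul (by simp [Matrix.det_fin_two]) (by simpa [Matrix.det_fin_two] using hm'), hP]

lemma twistSum_one : twistSum k f 1 = f := by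
  have : (!![1, 0; 0, 1] : Matrix (Fin 2) (Fin 2) ℝ) = 1 := Matrix.one_fin_two.symm
  simp [twistSum, coprimeSum, this, slash_one]

/-- Applying an eigenvalue equation for `T_p` inside a twisted sum. -/
lemma smul_twistSum (hp : 0 < p) (hm : 0 < m) {α : ℂ}
    (hα : heckeT k p f = fun z => α * f z) :
    α • twistSum k f m =
      coprimeSum m (fun b => slash k !![(p : ℝ), ((p * b : ℕ) : ℝ); 0, (m : ℝ)] f) +
      ∑ β ∈ Finset.range p, coprimeSum m
        (fun b => slash k !![1, ((b + β * m : ℕ) : ℝ); 0, ((p * m : ℕ) : ℝ)] f) := by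
  have hm' : (0 : ℝ) < m := by exact_mod_cast hm
  have hp' : (0 : ℝ) < p := by exact_mod_cast hp
  have hα' : α • f = slash k !![(p : ℝ), 0; 0, 1] f +
      ∑ β ∈ Finset.range p, slash k !![1, (β : ℝ); 0, (p : ℝ)] f := by
    funext z
    have := congrFun hα z
    simp only [heckeT] at this
    simp [← this]
  have key : ∀ b : ℕ, α • slash k !![1, (b : ℝ); 0, (m : ℝ)] f =
      slash k !![(p : ℝ), ((p * b : ℕ) : ℝ); 0, (m : ℝ)] f +
      ∑ β ∈ Finset.range p,
        slash k !![1, ((b + β * m : ℕ) : ℝ); 0, ((p * m : ℕ) : ℝ)] f := by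
    intro b
    rw [← slashLinear_apply, ← map_smul, hα', map_add, map_sum]
    simp only [slashLinear_apply]
    have hB : 0 < (!![1, (b : ℝ); 0, (m : ℝ)]).det := by simpa [Matrix.det_fin_two] using hm'
    rw [← slash_mul (by simpa [Matrix.det_fin_two] using hp') hB]
    congr 1
    · simp
    · refine Finset.sum_congr rfl fun β _ => ?_
      rw [← slash_mul (by simpa [Matrix.det_fin_two] using hp') hB]
      simp
  unfold twistSum coprimeSum
  rw [Finset.smul_sum, Finset.sum_comm, ← Finset.sum_add_distrib]
  exact Finset.sum_congr rfl fun b _ => key b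

lemma twistSum_mul_of_not_dvd (hp : p.Prime) (hm : 0 < m) (hpm : ¬ p ∣ m) {α : ℂ}
    (hP : slash k !![1, 1; 0, 1] f = f) (hα : heckeT k p f = fun z => α * f z) :
    twistSum k f (p * m) = α • twistSum k f m -
      slash k !![(p : ℝ), 0; 0, 1] (twistSum k f m) -
      slash k !![1, 0; 0, (p : ℝ)] (twistSum k f m) := by
  have hm' : (0 : ℝ) < m := by exact_mod_cast hm
  have hp' : (0 : ℝ) < p := by exact_mod_cast hp.pos
  have hB : ∀ b : ℕ, 0 < (!![1, (b : ℝ); 0, (m : ℝ)]).det := by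
    simpa [Matrix.det_fin_two] using hm'
  have h1 : coprimeSum m (fun b => slash k !![(p : ℝ), ((p * b : ℕ) : ℝ); 0, (m : ℝ)] f) =
      slash k !![(p : ℝ), 0; 0, 1] (twistSum k f m) := by
    rw [twistSum, ← coprimeSum_mul_left (hp.coprime_iff_not_dvd.mpr hpm)
      (slash_translate_periodic hm hP), slash_coprimeSum]
    refine coprimeSum_congr fun b => ?_
    rw [← slash_mul (hB _) (by simpa [Matrix.det_fin_two] using hp')]
    simp
  have h2 : coprimeSum m
        (fun b => slash k !![1, ((p * b : ℕ) : ℝ); 0, ((p * m : ℕ) : ℝ)] f) =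
      slash k !![1, 0; 0, (p : ℝ)] (twistSum k f m) := by
    rw [twistSum, slash_coprimeSum]
    refine coprimeSum_congr fun b => ?_
    rw [← slash_mul (hB _) (by simpa [Matrix.det_fin_two] using hp')]
    simp [mul_comm]
  rw [smul_twistSum hp.pos hm hα, h1, sum_range_coprimeSum_of_not_dvd hp hm hpm
    (fun c => slash k !![1, (c : ℝ); 0, ((p * m : ℕ) : ℝ)] f), h2, twistSum]
  abel

lemma exists_twistSum_mul_mul (hk : Even k) (hp : p.Prime) (hm : 0 < m) {α : ℂ}
    (hP : slash k !![1, 1; 0, 1] f = f) (hα : heckeT k p f = fun z => α * f z) :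
    ∃ c : ℤ, twistSum k f (p * (p * m)) =
      α • twistSum k f (p * m) - c • twistSum k f m := by
  have hm' : (0 : ℝ) < m := by exact_mod_cast hm
  have hp' : (0 : ℝ) < p := by exact_mod_cast hp.pos
  have hpm : 0 < p * m := Nat.mul_pos hp.pos hm
  obtain ⟨c, hc⟩ := exists_coprimeSum_mul (M := ℍ → ℂ) hp hm
  refine ⟨c, ?_⟩
  have h1 : coprimeSum (p * m)
        (fun b => slash k !![(p : ℝ), ((p * b : ℕ) : ℝ); 0, ((p * m : ℕ) : ℝ)] f) =
      c • twistSum k f m := by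
    rw [twistSum, ← hc _ (slash_translate_periodic hm hP)]
    refine coprimeSum_congr fun b => ?_
    rw [← slash_smul_matrix hk hp' (A := !![1, (b : ℝ); 0, (m : ℝ)])
      (by simpa [Matrix.det_fin_two] using hm)]
    simp [Matrix.smul_of]
  rw [smul_twistSum hp.pos hpm hα, h1, sum_range_coprimeSum_of_dvd hpm (dvd_mul_right p m)
    (fun c => slash k !![1, (c : ℝ); 0, ((p * (p * m) : ℕ) : ℝ)] f), twistSum]
  abel

/-- If `f` is an eigenfunction of `H_N` and of `T_p` for `p ∣ n`, then its twisted sums over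
divisors of `n` are eigenfunctions of `H_N` with the same eigenvalue. -/
lemma slash_twistSum {N n : ℕ} (hN : 0 < N) (hn : 0 < n) (hk : Even k) {ε : ℂ}
    (hP : slash k !![1, 1; 0, 1] f = f)
    (hH : slash k !![0, -1; (N : ℝ), 0] f = ε • f)
    (hT : ∀ p : ℕ, p.Prime → p ∣ n → ∃ α : ℂ, heckeT k p f = fun z => α * f z)
    (hmn : m ∣ n) :
    slash k !![0, -1; (N : ℝ), 0] (twistSum k f m) = ε • twistSum k f m := by
  induction m using Nat.strong_induction_on with
  | _ m ih =>
  have hm : 0 < m := Nat.pos_of_dvd_of_pos hmn hn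
  rcases eq_or_ne m 1 with rfl | hm1
  · rwa [twistSum_one]
  obtain ⟨p, hp, l, rfl⟩ := Nat.exists_prime_and_dvd hm1
  obtain ⟨α, hα⟩ := hT p hp ((dvd_mul_right p l).trans hmn)
  have hl : 0 < l := Nat.pos_of_mul_pos_left hm
  have hll : l < p * l := lt_mul_of_one_lt_left hl hp.one_lt
  have ihl := ih l hll ((dvd_mul_left l p).trans hmn)
  have hN' : (0 : ℝ) < N := by exact_mod_cast hN
  have hp' : (0 : ℝ) < p := by exact_mod_cast hp.pos
  by_cases hpl : p ∣ l
  · obtain ⟨r, rfl⟩ := hpl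
    have hr : 0 < r := Nat.pos_of_mul_pos_left hl
    have hrr : r < p * r := lt_mul_of_one_lt_left hr hp.one_lt
    have ihr := ih r (hrr.trans hll)
      (((dvd_mul_left r p).trans (dvd_mul_left (p * r) p)).trans hmn)
    obtain ⟨c, hc⟩ := exists_twistSum_mul_mul hk hp hr hP hα
    rw [← slashLinear_apply] at ihl ihr ⊢
    rw [hc, map_sub, map_smul, map_zsmul, ihl, ihr, smul_sub, smul_comm ε α, smul_comm ε c]
  · rw [twistSum_mul_of_not_dvd hp hl hpl hP hα]
    have hHdet : 0 < (!![0, -1; (N : ℝ), 0]).det := by simpa [Matrix.det_fin_two] using hN'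
    have hDdet : 0 < (!![(p : ℝ), 0; 0, 1]).det := by simpa [Matrix.det_fin_two] using hp'
    have hDdet' : 0 < (!![1, 0; 0, (p : ℝ)]).det := by simpa [Matrix.det_fin_two] using hp'
    have h1 : slash k !![0, -1; (N : ℝ), 0] (slash k !![(p : ℝ), 0; 0, 1] (twistSum k f l)) =
        ε • slash k !![1, 0; 0, (p : ℝ)] (twistSum k f l) := by
      rw [← slashLinear_apply (A := !![1, 0; 0, (p : ℝ)]), ← map_smul, ← ihl, slashLinear_apply,
        ← slash_mul hDdet hHdet, ← slash_mul hHdet hDdet']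
      simp
    have h2 : slash k !![0, -1; (N : ℝ), 0] (slash k !![1, 0; 0, (p : ℝ)] (twistSum k f l)) =
        ε • slash k !![(p : ℝ), 0; 0, 1] (twistSum k f l) := by
      rw [← slashLinear_apply (A := !![(p : ℝ), 0; 0, 1]), ← map_smul, ← ihl, slashLinear_apply,
        ← slash_mul hDdet' hHdet, ← slash_mul hHdet hDdet]
      simp [mul_comm]
    rw [← slashLinear_apply (A := !![0, -1; (N : ℝ), 0])] at ihl h1 h2 ⊢
    rw [map_sub, map_sub, map_smul, ihl, h1, h2, smul_sub, smul_sub, smul_comm ε α]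
    abel

end Twist

/-- **Theorem 2.** If `f|_k P = f`, `f|_k H_N = ε f`, and for each prime
`p | n` the function `f` is an eigenfunction of `T_p`, then
`f|_k (H_N R_n H_{n²N}) = f|_k R_n`, where `R_n` is the formal sum of the
matrices `((n,a),(0,n))` over `1 ≤ a ≤ n` with `gcd(a,n) = 1`. -/
theorem theorem_two
    (N : ℕ) (hNpos : 0 < N) (n : ℕ) (hnpos : 0 < n)
    (k : ℤ) (hkpos : 0 < k) (hkeven : Even k)
    (f : ℍ → ℂ) (ε : ℝ) (hε : ε = 1 ∨ ε = -1)
    (hP : slash k !![1, 1; 0, 1] f = f)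
    (hH : slash k !![0, -1; (N : ℝ), 0] f = fun z => (ε : ℂ) * f z)
    (hT : ∀ p : ℕ, p.Prime → p ∣ n → ∃ α : ℂ, heckeT k p f = fun z => α * f z) :
    (fun z => ∑ b ∈ (Finset.Icc 1 n).filter (fun b => Nat.Coprime b n),
      slash k (!![0, -1; (N : ℝ), 0] * !![(n : ℝ), (b : ℝ); 0, (n : ℝ)] *
        !![0, -1; ((n ^ 2 * N : ℕ) : ℝ), 0]) f z) =
    (fun z => ∑ b ∈ (Finset.Icc 1 n).filter (fun b => Nat.Coprime b n),
      slash k !![(n : ℝ), (b : ℝ); 0, (n : ℝ)] f z) := by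
  have hH' : slash k !![0, -1; (N : ℝ), 0] f = (ε : ℂ) • f := hH
  have hn' : (0 : ℝ) < n := by exact_mod_cast hnpos
  have hN' : (0 : ℝ) < N := by exact_mod_cast hNpos
  have hε2 : (ε : ℂ) * ε = 1 := by rcases hε with rfl | rfl <;> simp
  have hHdet : 0 < (!![0, -1; (N : ℝ), 0]).det := by simpa [Matrix.det_fin_two] using hN'
  have hHdet' : 0 < (!![0, -1; ((n ^ 2 * N : ℕ) : ℝ), 0]).det := by
    simp [Matrix.det_fin_two]
    positivity
  have hDdet : 0 < (!![(n : ℝ), 0; 0, 1]).det := by simpa [Matrix.det_fin_two] using hn'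
  have hB : ∀ b : ℕ, 0 < (!![1, (b : ℝ); 0, (n : ℝ)]).det := by
    simpa [Matrix.det_fin_two] using hn'
  have hfac : ∀ b : ℕ, !![(n : ℝ), (b : ℝ); 0, (n : ℝ)] =
      !![1, (b : ℝ); 0, (n : ℝ)] * !![(n : ℝ), 0; 0, 1] := by
    intro b
    simp
  have hfricke : !![(n : ℝ), 0; 0, 1] * !![0, -1; ((n ^ 2 * N : ℕ) : ℝ), 0] =
      (n : ℝ) • (!![0, -1; (N : ℝ), 0] * !![(n : ℝ), 0; 0, 1]) := by
    simp [Matrix.smul_of]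
    ring
  have hslash : ∀ b : ℕ, slash k !![(n : ℝ), (b : ℝ); 0, (n : ℝ)] f =
      slash k !![(n : ℝ), 0; 0, 1] (slash k !![1, (b : ℝ); 0, (n : ℝ)] f) := by
    intro b
    rw [hfac, slash_mul (hB b) hDdet]
  have hslash' : ∀ b : ℕ, slash k (!![0, -1; (N : ℝ), 0] * !![(n : ℝ), (b : ℝ); 0, (n : ℝ)] *
        !![0, -1; ((n ^ 2 * N : ℕ) : ℝ), 0]) f =
      (ε : ℂ) • slash k !![(n : ℝ), 0; 0, 1] (slash k !![0, -1; (N : ℝ), 0]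
        (slash k !![1, (b : ℝ); 0, (n : ℝ)] f)) := by
    intro b
    have hHD := mul_pos hHdet hDdet
    rw [← Matrix.det_mul] at hHD
    have hDH := mul_pos hDdet hHdet'
    rw [← Matrix.det_mul] at hDH
    rw [hfac, mul_assoc, mul_assoc, slash_mul hHdet (by
      rw [Matrix.det_mul]; exact mul_pos (hB b) hDH), hH', slash_mul (hB b) hDH, hfricke,
      slash_smul_matrix hkeven hn' hHD, slash_mul hHdet hDdet]
    simp only [← slashLinear_apply, map_smul]
  have hper := slash_translate_periodic (k := k) hnpos hP
  have hsum : ∀ L : (ℍ → ℂ) →ₗ[ℂ] (ℍ → ℂ),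
      ∑ b ∈ (Finset.Icc 1 n).filter (fun b => Nat.Coprime b n),
        L (slash k !![1, (b : ℝ); 0, (n : ℝ)] f) = L (twistSum k f n) := by
    intro L
    rw [← map_sum, sum_Icc_coprime hnpos hper, twistSum]
  funext z
  rw [← Finset.sum_apply z _ (fun b : ℕ => slash k (!![0, -1; (N : ℝ), 0] *
    !![(n : ℝ), (b : ℝ); 0, (n : ℝ)] * !![0, -1; ((n ^ 2 * N : ℕ) : ℝ), 0]) f),
    ← Finset.sum_apply z _ (fun b : ℕ => slash k !![(n : ℝ), (b : ℝ); 0, (n : ℝ)] f)]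
  simp only [hslash, hslash', ← Finset.smul_sum]
  have h1 := hsum (slashLinear k !![(n : ℝ), 0; 0, 1])
  have h2 := hsum (slashLinear k !![(n : ℝ), 0; 0, 1] ∘ₗ slashLinear k !![0, -1; (N : ℝ), 0])
  simp only [LinearMap.comp_apply] at h2
  rw [slashLinear_apply (f := twistSum k f n),
    slash_twistSum hNpos hnpos hkeven hP hH' hT dvd_rfl, map_smul] at h2
  simp only [slashLinear_apply] at h1 h2
  rw [h1, h2, smul_smul, hε2, one_smul]
end
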